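/- For every β ∈ (0,1) there exists α₁ ∈ (0, 1/12) such that: (i) φ(z) > 0 for every z = (x,y,t) with −α₁r² ≤ t ≤ 0 and (x,y) ∈ C_{βr}; and (ii) if moreover α₁ > θ, then 0 < φ₀(z) < 1 for every z = (x,y,t) with −α₁r² ≤ t ≤ −θr² and (x,y) ∈ C_{βr}. -/

import Mathlib

open Real Set

noncomputable section

/-- The properties of the cut-off profile `χ` associated with the parameters `θ, r`. -/
def ChiProp (θ r : ℝ) (χ : ℝ → ℝ) : Prop :=
  ContDiff ℝ (⊤ : ℕ∞) χ ∧
  AntitoneOn χ (Ici 0) ∧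
  (∀ s, 0 ≤ s → 0 ≤ χ s ∧ χ s ≤ 1) ∧
  (∀ s ∈ Icc 0 (θ ^ ((1:ℝ)/6) * r), χ s = 1) ∧
  (∀ s, r ≤ s → χ s = 0) ∧
  (∀ s ∈ Ico (0:ℝ) r, 0 < χ s) ∧
  (∀ s, θ ^ ((1:ℝ)/6) * r < s → χ s < 1) ∧
  (∀ s, 0 ≤ s → |deriv χ s| ≤ 2 / ((1 - θ ^ ((1:ℝ)/6)) * r))

/-- The cut-off `φ₀(x,y,t) = χ((θ²x² - 6tr⁴)^{1/6})`. -/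
def phi0 (θ r : ℝ) (χ : ℝ → ℝ) (z : ℝ × ℝ × ℝ) : ℝ :=
  χ ((θ ^ 2 * z.1 ^ 2 - 6 * z.2.2 * r ^ 4) ^ ((1:ℝ)/6))

/-- The cut-off `φ₁(x,y,t) = χ(θ|y|)`. -/
def phi1 (θ : ℝ) (χ : ℝ → ℝ) (z : ℝ × ℝ × ℝ) : ℝ := χ (θ * |z.2.1|)

/-- The full cut-off `φ = φ₀ φ₁`. -/
def phiCut (θ r : ℝ) (χ : ℝ → ℝ) (z : ℝ × ℝ × ℝ) : ℝ := phi0 θ r χ z * phi1 θ χ z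

/-- The region `Q_θ⁻ = {-r² ≤ t ≤ 0, |y| ≤ r/θ, |x| ≤ r³/θ}`. -/
def Qneg (θ r : ℝ) : Set (ℝ × ℝ × ℝ) :=
  {z | -r ^ 2 ≤ z.2.2 ∧ z.2.2 ≤ 0 ∧ |z.2.1| ≤ r / θ ∧ |z.1| ≤ r ^ 3 / θ}

theorem phi0_arg_lt {θ r β : ℝ} (hθ : θ ∈ Ioo (0:ℝ) ((2:ℝ) ^ 6)⁻¹) (hr : 0 < r)
    (hβ : β ∈ Ioo (0:ℝ) 1) {x t : ℝ} (ht : -(1 / 13 * r ^ 2) ≤ t) (hx : |x| < (β * r) ^ 3) :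
    θ ^ 2 * x ^ 2 - 6 * t * r ^ 4 < r ^ 6 := by
  obtain ⟨hθ0, hθ1⟩ := hθ
  have hβr : (β * r) ^ 3 ≤ r ^ 3 := by
    have : β * r ≤ r := by nlinarith [hβ.2]
    have : 0 ≤ β * r := mul_nonneg hβ.1.le hr.le
    gcongr
  have hx2 : x ^ 2 ≤ r ^ 6 := by
    have : |x| ^ 2 ≤ (r ^ 3) ^ 2 := by
      have := hx.le.trans hβr
      gcongr
    rw [sq_abs] at this
    linarith [show (r ^ 3) ^ 2 = r ^ 6 by ring]
  have hθ2 : θ ^ 2 ≤ 1 / 2 := by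
    norm_num at hθ1
    nlinarith
  have h1 : θ ^ 2 * x ^ 2 ≤ 1 / 2 * r ^ 6 := by gcongr
  have h2 : -(1 / 13 * r ^ 2) * r ^ 4 ≤ t * r ^ 4 := by gcongr
  have h3 : 0 < r ^ 6 := by positivity
  nlinarith

theorem phi0_pos {θ r β : ℝ} (hθ : θ ∈ Ioo (0:ℝ) ((2:ℝ) ^ 6)⁻¹) (hr : 0 < r)
    {χ : ℝ → ℝ} (hχ : ChiProp θ r χ) (hβ : β ∈ Ioo (0:ℝ) 1) {z : ℝ × ℝ × ℝ}
    (ht : -(1 / 13 * r ^ 2) ≤ z.2.2) (ht0 : z.2.2 ≤ 0) (hx : |z.1| < (β * r) ^ 3) :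
    0 < phi0 θ r χ z := by
  obtain ⟨-, -, -, -, -, hpos, -, -⟩ := hχ
  have hlt := phi0_arg_lt hθ hr hβ ht hx
  have h0 : 0 ≤ θ ^ 2 * z.1 ^ 2 - 6 * z.2.2 * r ^ 4 := by
    have h1 : z.2.2 * r ^ 4 ≤ 0 := mul_nonpos_of_nonpos_of_nonneg ht0 (by positivity)
    have h2 : 0 ≤ θ ^ 2 * z.1 ^ 2 := by positivity
    linarith
  refine hpos _ ⟨rpow_nonneg h0 _, ?_⟩
  calc (θ ^ 2 * z.1 ^ 2 - 6 * z.2.2 * r ^ 4) ^ ((1:ℝ)/6)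
      < (r ^ 6) ^ ((1:ℝ)/6) := rpow_lt_rpow h0 hlt (by norm_num)
    _ = r := by
      rw [← rpow_natCast, ← rpow_mul hr.le]
      norm_num

theorem phi0_lt_one {θ r : ℝ} (hθ : 0 < θ) (hr : 0 < r) {χ : ℝ → ℝ} (hχ : ChiProp θ r χ)
    {z : ℝ × ℝ × ℝ} (ht : z.2.2 ≤ -(θ * r ^ 2)) : phi0 θ r χ z < 1 := by
  obtain ⟨-, -, -, -, -, -, hlt, -⟩ := hχ
  refine hlt _ ?_
  calc θ ^ ((1:ℝ)/6) * r = (θ * r ^ 6) ^ ((1:ℝ)/6) := by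
        rw [mul_rpow hθ.le (by positivity), ← rpow_natCast, ← rpow_mul hr.le]
        norm_num
    _ < _ := by
      refine rpow_lt_rpow (by positivity) ?_ (by norm_num)
      have h1 : z.2.2 * r ^ 4 ≤ -(θ * r ^ 2) * r ^ 4 := by gcongr
      have h2 : 0 ≤ θ ^ 2 * z.1 ^ 2 := by positivity
      have h3 : 0 < θ * r ^ 6 := by positivity
      nlinarith

/-- Lemma 4.4 (4)-(5): for every `β ∈ (0,1)` there is `α₁ ∈ (0,1/12)` such that `φ > 0`
on `[-α₁r², 0] × C_{βr}`, and if `α₁ > θ` then `0 < φ₀ < 1` on `[-α₁r², -θr²] × C_{βr}`. -/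
theorem phiCut_positivity (θ r : ℝ) (hθ : θ ∈ Ioo (0:ℝ) ((2:ℝ) ^ 6)⁻¹)
    (hr : r ∈ Ioc (0:ℝ) 1) (χ : ℝ → ℝ) (hχ : ChiProp θ r χ)
    (β : ℝ) (hβ : β ∈ Ioo (0:ℝ) 1) :
    ∃ α₁ ∈ Ioo (0:ℝ) (1/12),
      (∀ z : ℝ × ℝ × ℝ,
        -(α₁ * r ^ 2) ≤ z.2.2 → z.2.2 ≤ 0 → |z.1| < (β * r) ^ 3 → |z.2.1| < β * r →
        0 < phiCut θ r χ z) ∧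
      (θ < α₁ →
        ∀ z : ℝ × ℝ × ℝ,
          -(α₁ * r ^ 2) ≤ z.2.2 → z.2.2 ≤ -(θ * r ^ 2) →
          |z.1| < (β * r) ^ 3 → |z.2.1| < β * r →
          0 < phi0 θ r χ z ∧ phi0 θ r χ z < 1) := by
  refine ⟨1 / 13, by norm_num, fun z ht ht0 hx hy => ?_, fun _ z ht htθ hx _ => ?_⟩
  · refine mul_pos (phi0_pos hθ hr.1 hχ hβ ht ht0 hx) ?_
    obtain ⟨-, -, -, -, -, hpos, -, -⟩ := hχ
    refine hpos _ ⟨mul_nonneg hθ.1.le (abs_nonneg _), ?_⟩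
    have hθ1 : θ < 1 := hθ.2.trans (by norm_num)
    have hβr : β * r < r := by nlinarith [hβ.2, hr.1]
    nlinarith [abs_nonneg z.2.1]
  · have ht0 : z.2.2 ≤ 0 := by
      have : 0 ≤ θ * r ^ 2 := mul_nonneg hθ.1.le (sq_nonneg r)
      linarith
    exact ⟨phi0_pos hθ hr.1 hχ hβ ht ht0 hx, phi0_lt_one hθ.1 hr.1 hχ htθ⟩

end
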